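/- arXiv:2603.29714 — 3 statements merged into one kernel-verified Lean document; each statement's English description precedes it below -/
import Mathlib

section
/- Let x, z ∈ P. For every α ∈ S_x ⊆ *E_x and every degree-preserving S-homomorphism φ : *E_x → *E_z, one has φ(α) ∈ S_z. In particular φ(1_x) = c·1_z for some c ∈ K. -/
open scoped Classical
open MvPolynomial

noncomputable section

variable (K : Type) [Field K]
variable (P : Type) [Fintype P] [PartialOrder P] [OrderBot P]

/-- A finite poset with a least element is *simplicial* if every lower interval
is isomorphic to a boolean algebra (the lattice of all subsets of a finite set). -/
def IsSimplicialPoset : Prop :=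
  ∀ x : P, ∃ m : ℕ, Nonempty (Set.Iic x ≃o Finset (Fin m))

/-- `P* := P \ {0̂}`. -/
abbrev Pstar := {z : P // z ≠ ⊥}

/-- The polynomial ring `S = K[t_z : z ∈ P*]`. -/
abbrev FaceS := MvPolynomial (Pstar P) K

/-- The variable `t_z`, with the convention `t_{0̂} = 1`. -/
def tvar (z : P) : FaceS K P := if h : z = ⊥ then 1 else X ⟨z, h⟩

/-- The set `[a ∨ b]` of minimal elements of the common upper bounds of `a` and `b`. -/
def minUB (a b : P) : Set P :=
  {z | a ≤ z ∧ b ≤ z ∧ ∀ w, a ≤ w → b ≤ w → ¬ w < z}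

/-- Minimal elements of the common upper bounds of a set `A`. -/
def minUBset (A : Set P) : Set P :=
  {z | (∀ a ∈ A, a ≤ z) ∧ ∀ w, (∀ a ∈ A, a ≤ w) → ¬ w < z}

/-- The meet `a ∧ b`, i.e. the largest common lower bound, when it exists (`⊥` otherwise). -/
def pmeet (a b : P) : P :=
  if h : ∃ m, m ≤ a ∧ m ≤ b ∧ ∀ w, w ≤ a → w ≤ b → w ≤ m then h.choose else ⊥

/-- The generator `f_{a,b} = t_a t_b - t_{a ∧ b} ∑_{z ∈ [a ∨ b]} t_z` of the face ideal. -/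
def fgen (a b : Pstar P) : FaceS K P :=
  X a * X b - tvar K P (pmeet P a.1 b.1) *
    ∑ z ∈ (Set.toFinite (minUB P a.1 b.1)).toFinset, tvar K P z

/-- The face ideal `I_P`. -/
def faceIdeal : Ideal (FaceS K P) :=
  Ideal.span (Set.range fun p : Pstar P × Pstar P => fgen K P p.1 p.2)

variable (n : ℕ) (y : Fin n → P)

/-- `y` is an enumeration of the rank one elements (= atoms) of `P`. -/
def AtomEnum : Prop :=
  Function.Injective y ∧ ∀ p : P, IsAtom p ↔ ∃ i, y i = p

/-- The rank of an element: the number of atoms below it. -/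
def prank (z : P) : ℕ := (Finset.univ.filter fun i : Fin n => y i ≤ z).card

/-- The `ℤⁿ`-degree of the variable `t_z`: `deg t_z = ∑_{y_i ≤ z} e_i`. -/
def tdeg (z : Pstar P) : Fin n → ℤ := fun i => if y i ≤ z.1 then 1 else 0

/-- `w = ∑_{z ∈ P*} deg t_z`. -/
def wvec : Fin n → ℤ := fun i => ∑ z : Pstar P, tdeg P n y z i

/-- The degree `d` homogeneous component of `S` for the `ℤⁿ`-grading. -/
def Sgrade (d : Fin n → ℤ) : AddSubgroup (FaceS K P) :=
  (weightedHomogeneousSubmodule K (tdeg P n y) d).toAddSubgroup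

/-- The transformed variable `t̃_z` (relative to `x`), with `t̃_{0̂} = 1`. -/
def ttil (x z : P) : FaceS K P :=
  if z ≤ x ∧ 2 ≤ prank P n y z then
    tvar K P z - ∏ i ∈ Finset.univ.filter fun i : Fin n => y i ≤ z, tvar K P (y i)
  else tvar K P z

/-- The graded prime ideal `p_x = (t_z : z ≰ x) + I_P`. -/
def pIdeal (x : P) : Ideal (FaceS K P) :=
  Ideal.span ((fun z : Pstar P => (X z : FaceS K P)) '' {z | ¬ z.1 ≤ x}) ⊔ faceIdeal K P

/-- The indices of the atoms below `x`. -/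
abbrev BelowIx (x : P) := {i : Fin n // y i ≤ x}

/-- `P*_{-x}`: the elements of `P*` which are not atoms below `x`. -/
abbrev Pmx (x : P) := {z : P // z ≠ ⊥ ∧ ¬ ∃ i : Fin n, y i ≤ x ∧ y i = z}

/-- Index monoid for the "big Laurent" model of `*E_x`. -/
abbrev EIdx (x : P) := (BelowIx P n y x →₀ ℤ) × (Pmx P n y x →₀ ℤ)

/-- The "big Laurent" algebra `K[t_i^{±1} : y_i ≤ x] ⊗_K K[t̃_z^{±1} : z ∈ P*_{-x}]`. -/
abbrev Gx (x : P) := AddMonoidAlgebra K (EIdx P n y x)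

/-- Exponent vector of `π_x(t_z) = ∏_{y_i ≤ z} t_i`. -/
def dvec (x : P) (z : P) : BelowIx P n y x →₀ ℤ :=
  Finsupp.equivFunOnFinite.symm fun i => if y i.1 ≤ z then 1 else 0

/-- The action of `S` on the big Laurent algebra through the comultiplication
`Δ(t_z) = t_z ⊗ 1 + 1 ⊗ t_z`:  the variable `t_z` acts as `π_x(t_z) ⊗ 1 + 1 ⊗ t_z`. -/
def theta (x : P) : FaceS K P →ₐ[K] Gx K P n y x :=
  aeval fun z : Pstar P =>
    (if z.1 ≤ x then AddMonoidAlgebra.single (dvec P n y x z.1, 0) 1 else 0) +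
    (if h : ∃ i : Fin n, y i ≤ x ∧ y i = z.1 then 0
     else AddMonoidAlgebra.single
       ((0 : BelowIx P n y x →₀ ℤ), Finsupp.single (⟨z.1, z.2, h⟩ : Pmx P n y x) (1 : ℤ)) 1)

instance gxModule (x : P) : Module (FaceS K P) (Gx K P n y x) :=
  Module.compHom _ (theta K P n y x).toRingHom

instance gxTower (x : P) : IsScalarTower K (FaceS K P) (Gx K P n y x) := by
  refine ⟨fun k s g => ?_⟩
  show theta K P n y x (k • s) * g = k • (theta K P n y x s * g)
  rw [map_smul, smul_mul_assoc]

instance gxComm (x : P) : SMulCommClass (FaceS K P) K (Gx K P n y x) := by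
  refine ⟨fun s k g => ?_⟩
  show theta K P n y x s * (k • g) = k • (theta K P n y x s * g)
  exact mul_smul_comm k _ g

/-- The submodule by which we quotient the big Laurent algebra to obtain `*E_x`. -/
def Ux (x : P) : Submodule (FaceS K P) (Gx K P n y x) :=
  Submodule.span (FaceS K P)
    {g | ∃ p : EIdx P n y x, (∃ w, 0 < p.2 w) ∧ g = AddMonoidAlgebra.single p 1}

/-- The `ℤⁿ`-graded `S`-module `*E_x = K[t_i^{±1} : y_i ≤ x] ⊗_K K[t_z^{-1} : z ∈ P*_{-x}]`. -/
abbrev ExMod (x : P) := Gx K P n y x ⧸ Ux K P n y x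

instance exComm (x : P) : SMulCommClass (FaceS K P) K (ExMod K P n y x) := by
  refine ⟨fun s k e => ?_⟩
  obtain ⟨g, rfl⟩ := Submodule.Quotient.mk_surjective _ e
  simp only [← Submodule.Quotient.mk_smul]
  rw [smul_comm]

def mIdx (x : P) (a : BelowIx P n y x →₀ ℤ) (b : Pmx P n y x →₀ ℕ) : EIdx P n y x :=
  (a, -Finsupp.mapRange (Nat.cast : ℕ → ℤ) Nat.cast_zero b)

/-- The monomial `∏ t_i^{a_i} ⊗ ∏ t_z^{-b_z}` of `*E_x`. -/
def emono (x : P) (a : BelowIx P n y x →₀ ℤ) (b : Pmx P n y x →₀ ℕ) : ExMod K P n y x :=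
  Submodule.Quotient.mk (AddMonoidAlgebra.single (mIdx P n y x a b) 1)

/-- `1_x = 1 ⊗ 1 ∈ *E_x`. -/
def onex (x : P) : ExMod K P n y x := emono K P n y x 0 0

/-- The `ℤⁿ`-degree of the monomial of `*E_x` with index `p`. -/
def gdeg (x : P) (p : EIdx P n y x) : Fin n → ℤ := fun i =>
  (if h : y i ≤ x then p.1 ⟨i, h⟩ else 0) +
    p.2.sum fun w c => c * (if y i ≤ w.1 then 1 else 0)

/-- The degree `aa` homogeneous component of `*E_x`. -/
def ExGrade (x : P) (aa : Fin n → ℤ) : Submodule K (ExMod K P n y x) :=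
  Submodule.span K
    {e | ∃ p : EIdx P n y x, gdeg P n y x p = aa ∧
      e = Submodule.Quotient.mk (AddMonoidAlgebra.single p 1)}

/-- `L(*E_x)`: the span of the basis monomials with nontrivial second factor and
componentwise nonnegative `ℤⁿ`-degree. -/
def cleanL (x : P) : Submodule K (ExMod K P n y x) :=
  Submodule.span K
    {e | ∃ a b, b ≠ 0 ∧ (∀ i, 0 ≤ gdeg P n y x (mIdx P n y x a b) i) ∧
      e = emono K P n y x a b}

/-- Degree preserving homomorphisms `*E_x → *E_z` (elements of `[*Hom(E_x, E_z)]_0`). -/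
def DegZero (x z : P) (φ : ExMod K P n y x →ₗ[FaceS K P] ExMod K P n y z) : Prop :=
  ∀ aa, ∀ e ∈ ExGrade K P n y x aa, φ e ∈ ExGrade K P n y z aa

/-- Clean homomorphisms `*E_x → *E_z`. -/
def IsClean (x z : P) (φ : ExMod K P n y x →ₗ[FaceS K P] ExMod K P n y z) : Prop :=
  DegZero K P n y x z φ ∧ ∀ e ∈ cleanL K P n y x, φ e ∈ cleanL K P n y z


section Membership

variable {K P n y}

omit [Fintype P] in
theorem gx_smul_def {x : P} (s : FaceS K P) (g : Gx K P n y x) :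
    s • g = theta K P n y x s * g := rfl

omit [Fintype P] in
/-- A monomial with nonnegative second exponent does not enlarge the set of exponents outside
`Ux` on which an element is supported. -/
theorem coeff_single_mul_eq_zero {x : P} {g : Gx K P n y x}
    (hg : ∀ p : EIdx P n y x, (∀ w, p.2 w ≤ 0) → g.coeff p = 0)
    {q : EIdx P n y x} (hq : ∀ w, 0 ≤ q.2 w) (c : K) (p : EIdx P n y x) (hp : ∀ w, p.2 w ≤ 0) :
    (AddMonoidAlgebra.single q c * g).coeff p = 0 := by
  rw [AddMonoidAlgebra.coeff_single_mul_apply, hg, mul_zero]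
  intro w
  have h₁ := hq w
  have h₂ := hp w
  simp only [Prod.snd_add, Prod.snd_neg, Finsupp.add_apply, Finsupp.neg_apply]
  omega

omit [Fintype P] in
theorem coeff_smul_eq_zero {x : P} (s : FaceS K P) {g : Gx K P n y x}
    (hg : ∀ p : EIdx P n y x, (∀ w, p.2 w ≤ 0) → g.coeff p = 0)
    (p : EIdx P n y x) (hp : ∀ w, p.2 w ≤ 0) : (s • g).coeff p = 0 := by
  induction s using MvPolynomial.induction_on generalizing g p with
  | C a =>
    rw [gx_smul_def, theta, aeval_C, Algebra.algebraMap_eq_smul_one, smul_mul_assoc, one_mul,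
      AddMonoidAlgebra.coeff_smul_apply, hg p hp, smul_zero]
  | add s t hs ht =>
    rw [add_smul, AddMonoidAlgebra.coeff_add, Finsupp.add_apply, hs hg p hp, ht hg p hp, add_zero]
  | mul_X s z hs =>
    rw [mul_smul]
    refine hs (fun p hp => ?_) p hp
    rw [gx_smul_def, theta, aeval_X, add_mul, AddMonoidAlgebra.coeff_add, Finsupp.add_apply]
    have h₁ := coeff_single_mul_eq_zero hg (q := (dvec P n y x z.1, 0)) (fun w => le_rfl) 1 p hp
    split_ifs with hz h h
    · simp [h₁]
    · rw [h₁, coeff_single_mul_eq_zero hg _ 1 p hp, add_zero]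
      exact fun w => (Finsupp.single_nonneg.2 zero_le_one : (0 : Pmx P n y x →₀ ℤ) ≤ _) w
    · simp
    · rw [coeff_single_mul_eq_zero hg _ 1 p hp, zero_mul]
      · simp
      · exact fun w => (Finsupp.single_nonneg.2 zero_le_one : (0 : Pmx P n y x →₀ ℤ) ≤ _) w

omit [Fintype P] in
theorem coeff_eq_zero_of_mem_Ux {x : P} {g : Gx K P n y x} (hg : g ∈ Ux K P n y x)
    (p : EIdx P n y x) (hp : ∀ w, p.2 w ≤ 0) : g.coeff p = 0 := by
  induction hg using Submodule.span_induction generalizing p with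
  | mem g hg =>
    obtain ⟨q, ⟨w, hw⟩, rfl⟩ := hg
    rw [AddMonoidAlgebra.coeff_single, Finsupp.single_apply, if_neg]
    rintro rfl
    exact (hp w).not_gt hw
  | zero => simp
  | add g h _ _ hg hh => simp [hg p hp, hh p hp]
  | smul s g _ hg => exact coeff_smul_eq_zero s hg p hp

/-- Homogeneous elements have representatives supported on exponents of the right degree whose
second component is nonpositive. -/
theorem exists_rep_of_mem_ExGrade {x : P} {d : Fin n → ℤ} {e : ExMod K P n y x}
    (he : e ∈ ExGrade K P n y x d) :
    ∃ g : Gx K P n y x, Submodule.Quotient.mk g = e ∧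
      ∀ p, g.coeff p ≠ 0 → gdeg P n y x p = d ∧ ∀ w, p.2 w ≤ 0 := by
  induction he using Submodule.span_induction with
  | mem e he =>
    obtain ⟨p, hp, rfl⟩ := he
    by_cases h : ∃ w, 0 < p.2 w
    · refine ⟨0, ?_, by simp⟩
      rw [Submodule.Quotient.mk_zero, eq_comm, Submodule.Quotient.mk_eq_zero]
      exact Submodule.subset_span ⟨p, h, rfl⟩
    · push Not at h
      refine ⟨AddMonoidAlgebra.single p 1, rfl, fun q hq => ?_⟩
      obtain rfl : p = q := by
        by_contra hne
        simp [hne] at hq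
      exact ⟨hp, h⟩
  | zero => exact ⟨0, rfl, by simp⟩
  | add e f _ _ he hf =>
    obtain ⟨g, rfl, hg⟩ := he
    obtain ⟨h, rfl, hh⟩ := hf
    refine ⟨g + h, rfl, fun p hp => ?_⟩
    by_cases h0 : g.coeff p = 0
    · exact hh p fun h1 => hp (by simp [h0, h1])
    · exact hg p h0
  | smul c e _ he =>
    obtain ⟨g, rfl, hg⟩ := he
    refine ⟨c • g, rfl, fun p hp => hg p fun h0 => hp ?_⟩
    rw [AddMonoidAlgebra.coeff_smul_apply, h0, smul_zero]

end Membership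

section Action

variable {K P n y}

omit [Fintype P] in
theorem theta_tvar_atom (hy : AtomEnum P n y) {x : P} {i : Fin n} (hi : y i ≤ x) :
    theta K P n y x (tvar K P (y i)) = AddMonoidAlgebra.single (dvec P n y x (y i), 0) 1 := by
  have h : y i ≠ ⊥ := ((hy.2 (y i)).2 ⟨i, rfl⟩).1
  rw [tvar, dif_neg h, theta, aeval_X, if_pos hi, dif_pos ⟨i, hi, rfl⟩, add_zero]

omit [Fintype P] in
theorem sum_dvec_atoms (hy : AtomEnum P n y) (x w : P) :
    ∑ i ∈ Finset.univ.filter (fun i : Fin n => y i ≤ w), dvec P n y x (y i) =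
      dvec P n y x w := by
  ext j
  have hij : ∀ i, y j.1 ≤ y i ↔ j.1 = i := fun i => by
    refine ⟨fun h => hy.1 ?_, fun h => h ▸ le_rfl⟩
    have hi : IsAtom (y i) := (hy.2 _).2 ⟨i, rfl⟩
    have hj : IsAtom (y j.1) := (hy.2 _).2 ⟨j.1, rfl⟩
    exact (hi.le_iff.1 h).resolve_left hj.1
  simp [Finsupp.finsetSum_apply, dvec, hij]

omit [Fintype P] in
theorem theta_prod_atoms (hy : AtomEnum P n y) {x w : P} (h : ∀ i, y i ≤ w → y i ≤ x) :
    theta K P n y x (∏ i ∈ Finset.univ.filter (fun i : Fin n => y i ≤ w), tvar K P (y i)) =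
      AddMonoidAlgebra.single (dvec P n y x w, 0) 1 := by
  rw [map_prod, Finset.prod_congr rfl fun i hi =>
    theta_tvar_atom hy (h i (Finset.mem_filter.1 hi).2), AddMonoidAlgebra.prod_single,
    Finset.prod_const_one]
  congr 1
  ext1
  · rw [Prod.fst_sum, sum_dvec_atoms hy]
  · simp [Prod.snd_sum]

/-- The polynomial acting on `*E_x` as `1 ⊗ t_w`. -/
def secondFactorVar (K P : Type) [Field K] [Fintype P] [PartialOrder P] [OrderBot P]
    (n : ℕ) (y : Fin n → P) (x : P) (w : Pstar P) : FaceS K P :=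
  X w - if w.1 ≤ x then
    ∏ i ∈ Finset.univ.filter (fun i : Fin n => y i ≤ w.1), tvar K P (y i) else 0

/-- If all atoms below `w` lie below `z`, then `secondFactorVar K P n y x w` acts on `*E_z` as
`1 ⊗ t_w` up to a multiple of an invertible monomial. -/
theorem theta_secondFactorVar (hy : AtomEnum P n y) (x z : P) (w : Pmx P n y z)
    (hw : w.1 ≤ x ∨ w.1 ≤ z → ∀ i, y i ≤ w.1 → y i ≤ z) :
    theta K P n y z (secondFactorVar K P n y x ⟨w.1, w.2.1⟩) =
      AddMonoidAlgebra.single (dvec P n y z w.1, 0)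
        ((if w.1 ≤ z then 1 else 0) - (if w.1 ≤ x then 1 else 0)) +
      AddMonoidAlgebra.single (0, Finsupp.single w 1) 1 := by
  have hX : theta K P n y z (X ⟨w.1, w.2.1⟩) =
      (if w.1 ≤ z then AddMonoidAlgebra.single (dvec P n y z w.1, 0) 1 else 0) +
        AddMonoidAlgebra.single (0, Finsupp.single w 1) 1 := by
    rw [theta, aeval_X, dif_neg w.2.2]
  rw [secondFactorVar, map_sub, hX, AddMonoidAlgebra.single_sub]
  by_cases hx : w.1 ≤ x
  · rw [if_pos hx, if_pos hx, theta_prod_atoms hy (hw (.inl hx))]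
    split_ifs <;> simp <;> abel
  · rw [if_neg hx, if_neg hx]
    split_ifs <;> simp

theorem secondFactorVar_smul_onex (hy : AtomEnum P n y) (x : P) (w : Pmx P n y x) :
    secondFactorVar K P n y x ⟨w.1, w.2.1⟩ • onex K P n y x = 0 := by
  have hw := theta_secondFactorVar (K := K) hy x x w (fun h i hi => hi.trans (or_self_iff.1 h))
  rw [sub_self, AddMonoidAlgebra.single_zero, zero_add] at hw
  rw [onex, emono, ← Submodule.Quotient.mk_smul, gx_smul_def, hw,
    AddMonoidAlgebra.single_mul_single, Submodule.Quotient.mk_eq_zero]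
  refine Submodule.subset_span ⟨_, ⟨w, ?_⟩, by rw [one_mul]⟩
  simp [mIdx]

omit [Fintype P] in
/-- If a multiple of an invertible monomial plus `1 ⊗ t_w` kills the class of `g`, then `g` does
not involve `t_w`. -/
theorem snd_apply_eq_zero_of_mul_mem_Ux {x : P} {g : Gx K P n y x}
    (hg : ∀ p, g.coeff p ≠ 0 → ∀ w, p.2 w ≤ 0) (d : BelowIx P n y x →₀ ℤ) (c : K)
    (w : Pmx P n y x)
    (h : (AddMonoidAlgebra.single (d, 0) c +
      AddMonoidAlgebra.single (0, Finsupp.single w 1) 1) * g ∈ Ux K P n y x)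
    (p : EIdx P n y x) (hp : g.coeff p ≠ 0) : p.2 w = 0 := by
  have key : ∀ q : EIdx P n y x, (∀ v, q.2 v ≤ 0) →
      c * g.coeff (-(d, 0) + q) + g.coeff (-(0, Finsupp.single w 1) + q) = 0 := fun q hq => by
    have := coeff_eq_zero_of_mem_Ux h q hq
    rwa [add_mul, AddMonoidAlgebra.coeff_add, Finsupp.add_apply,
      AddMonoidAlgebra.coeff_single_mul_apply, AddMonoidAlgebra.coeff_single_mul_apply,
      one_mul] at this
  by_cases hc : c = 0
  · by_contra hne
    have hlt : p.2 w < 0 := lt_of_le_of_ne (hg p hp w) hne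
    refine hp ?_
    have := key ((0, Finsupp.single w 1) + p) fun v => ?_
    · rwa [hc, zero_mul, zero_add, neg_add_cancel_left] at this
    · have hv := hg p hp v
      rcases eq_or_ne w v with rfl | hwv
      · simp only [Prod.snd_add, Finsupp.add_apply, Finsupp.single_eq_same]
        omega
      · simpa [Finsupp.single_apply, hwv] using hv
  · exfalso
    obtain ⟨q, hq, hmin⟩ := g.coeff.support.exists_min_image (fun q => q.2 w)
      ⟨p, Finsupp.mem_support_iff.2 hp⟩
    rw [Finsupp.mem_support_iff] at hq
    have h0 := key ((d, 0) + q) fun v => by simpa using hg q hq v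
    have h1 : g.coeff (-(0, Finsupp.single w 1) + ((d, 0) + q)) = 0 := by
      by_contra hne
      have := hmin _ (Finsupp.mem_support_iff.2 hne)
      simp at this
    rw [h1, neg_add_cancel_left, add_zero] at h0
    exact hq ((mul_eq_zero.1 h0).resolve_left hc)

/-- In degree zero with nonpositive second component, only elements all of whose atoms lie
below `x` occur. -/
theorem snd_apply_eq_zero_of_gdeg_eq_zero {x : P} {p : EIdx P n y x}
    (hdeg : gdeg P n y x p = 0) (hp : ∀ v, p.2 v ≤ 0) (w : Pmx P n y x) {i : Fin n}
    (hiw : y i ≤ w.1) (hix : ¬ y i ≤ x) : p.2 w = 0 := by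
  have h := congrFun hdeg i
  rw [gdeg, dif_neg hix, zero_add, Pi.zero_apply, Finsupp.sum_fintype _ _ (by simp),
    Finset.sum_eq_zero_iff_of_nonpos] at h
  · simpa [hiw] using h w (Finset.mem_univ w)
  · intro v _
    exact mul_nonpos_of_nonpos_of_nonneg (hp v) (by split_ifs <;> simp)

omit [Fintype P] in
theorem eq_zero_of_gdeg_eq_zero {x : P} {p : EIdx P n y x}
    (hdeg : gdeg P n y x p = 0) (hp : p.2 = 0) : p = 0 := by
  ext i
  · have h := congrFun hdeg i.1
    simpa [gdeg, hp, i.2] using h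
  · simp [hp]

omit [Fintype P] in
theorem onex_mem_ExGrade (x : P) : onex K P n y x ∈ ExGrade K P n y x 0 :=
  Submodule.subset_span ⟨_, by ext i; simp [gdeg, mIdx], rfl⟩

theorem map_onex_eq_smul (hy : AtomEnum P n y) {x z : P}
    (φ : ExMod K P n y x →ₗ[FaceS K P] ExMod K P n y z) (hφ : DegZero K P n y x z φ) :
    ∃ c : K, φ (onex K P n y x) = c • onex K P n y z := by
  obtain ⟨g, hg, hsupp⟩ := exists_rep_of_mem_ExGrade (hφ 0 _ (onex_mem_ExGrade x))
  have hzero : ∀ p, g.coeff p ≠ 0 → p = 0 := fun p hp => by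
    obtain ⟨hdeg, hle⟩ := hsupp p hp
    refine eq_zero_of_gdeg_eq_zero hdeg (Finsupp.ext fun w => ?_)
    by_cases hw : ∀ i, y i ≤ w.1 → y i ≤ z
    · have hwx : ¬ ∃ i, y i ≤ x ∧ y i = w.1 := fun ⟨i, _, hi⟩ =>
        w.2.2 ⟨i, hw i hi.le, hi⟩
      have hkill := congrArg φ (secondFactorVar_smul_onex (K := K) hy x ⟨w.1, w.2.1, hwx⟩)
      rw [map_smul, map_zero, ← hg, ← Submodule.Quotient.mk_smul,
        Submodule.Quotient.mk_eq_zero, gx_smul_def,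
        theta_secondFactorVar hy x z w fun _ => hw] at hkill
      exact snd_apply_eq_zero_of_mul_mem_Ux (fun q hq => (hsupp q hq).2) _ _ w hkill p hp
    · push Not at hw
      obtain ⟨i, hiw, hiz⟩ := hw
      exact snd_apply_eq_zero_of_gdeg_eq_zero hdeg hle w hiw hiz
  refine ⟨g.coeff 0, ?_⟩
  have hrep : g = g.coeff 0 • AddMonoidAlgebra.single (mIdx P n y z 0 0) 1 := by
    have h0 : mIdx P n y z 0 0 = 0 := by simp [mIdx]
    ext p
    by_cases hp : p = 0
    · simp [hp, h0]
    · have : g.coeff p = 0 := by_contra fun h => hp (hzero p h)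
      simp [this, h0, Ne.symm hp]
  rw [← hg, onex, emono, ← Submodule.Quotient.mk_smul, ← hrep]

end Action

/-- Lemma 3.1: for `α ∈ S_x ⊆ *E_x` and a degree preserving
`S`-homomorphism `φ : *E_x → *E_z`, we have `φ(α) ∈ S_z`; in particular
`φ(1_x) = c • 1_z` for some `c ∈ K`. -/
theorem statement7
    (hP : IsSimplicialPoset P) (hy : AtomEnum P n y) (x z : P)
    (φ : ExMod K P n y x →ₗ[FaceS K P] ExMod K P n y z)
    (hφ : DegZero K P n y x z φ) :
    (∀ α ∈ Submodule.span (FaceS K P) {onex K P n y x},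
        φ α ∈ Submodule.span (FaceS K P) {onex K P n y z}) ∧
    ∃ c : K, φ (onex K P n y x) = c • onex K P n y z := by
  obtain ⟨c, hc⟩ := map_onex_eq_smul hy φ hφ
  refine ⟨fun α hα => ?_, c, hc⟩
  obtain ⟨s, rfl⟩ := Submodule.mem_span_singleton.1 hα
  rw [map_smul, hc, smul_comm]
  exact Submodule.smul_of_tower_mem _ c
    (Submodule.smul_mem _ s (Submodule.mem_span_singleton_self _))

end
end

section
/- Let x, z ∈ P with z ≤ x and rank x ≥ 2. Then there exists a nonzero degree-preserving S-homomorphism φ : *E_x → *E_z with φ(1_x) = 0, i.e. φ|_{S_x} = 0. Consequently the K-vector space of degree-preserving S-homomorphisms *E_x → *E_z is infinite dimensional. -/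
open scoped Classical
open MvPolynomial

noncomputable section

variable (K : Type) [Field K]
variable (P : Type) [Fintype P] [PartialOrder P] [OrderBot P]

variable (n : ℕ) (y : Fin n → P)

/-- The `K`-subspace of degree preserving `S`-homomorphisms `*E_x → *E_z`,
i.e. `[*Hom_S(*E_x, *E_z)]_0`. -/
def degZeroSub (x z : P) :
    Submodule K (ExMod K P n y x →ₗ[FaceS K P] ExMod K P n y z) where
  carrier := {φ | DegZero K P n y x z φ}
  add_mem' := by
    intro φ ψ hφ hψ aa e he
    rw [LinearMap.add_apply]
    exact (ExGrade K P n y z aa).add_mem (hφ aa e he) (hψ aa e he)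
  zero_mem' := by
    intro aa e he
    rw [LinearMap.zero_apply]
    exact (ExGrade K P n y z aa).zero_mem
  smul_mem' := by
    intro c φ hφ aa e he
    rw [LinearMap.smul_apply]
    exact (ExGrade K P n y z aa).smul_mem c (hφ aa e he)

set_option linter.unusedSectionVars false

section GradedSupport

variable {K P n y}

lemma coeff_mul_ne_zero {x : P} {f g : Gx K P n y x} {p : EIdx P n y x}
    (h : (f * g).coeff p ≠ 0) :
    ∃ a b, f.coeff a ≠ 0 ∧ g.coeff b ≠ 0 ∧ a + b = p := by
  contrapose! h
  rw [AddMonoidAlgebra.coeff_mul, Finsupp.sum]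
  refine Finset.sum_eq_zero fun a ha => Finset.sum_eq_zero fun b hb => if_neg ?_
  exact h a b (Finsupp.mem_support_iff.1 ha) (Finsupp.mem_support_iff.1 hb)

lemma gdeg_apply (x : P) (p : EIdx P n y x) (i : Fin n) :
    gdeg P n y x p i = (if h : y i ≤ x then p.1 ⟨i, h⟩ else 0) +
      ∑ w, p.2 w * (if y i ≤ w.1 then 1 else 0) := by
  rw [gdeg, Finsupp.sum_fintype _ _ (by simp)]

lemma gdeg_zero (x : P) : gdeg P n y x 0 = 0 := by
  funext i; simp [gdeg]

lemma gdeg_add (x : P) (p q : EIdx P n y x) :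
    gdeg P n y x (p + q) = gdeg P n y x p + gdeg P n y x q := by
  funext i
  simp only [gdeg_apply, Pi.add_apply, Prod.fst_add, Prod.snd_add, Finsupp.add_apply, add_mul,
    Finset.sum_add_distrib]
  split_ifs <;> ring

lemma gdeg_neg (x : P) (p : EIdx P n y x) : gdeg P n y x (-p) = -gdeg P n y x p := by
  rw [eq_neg_iff_add_eq_zero, ← gdeg_add, neg_add_cancel, gdeg_zero]

/-- `g` is homogeneous of degree `d`, and the exponents of the inverse variables occurring in `g`
are bounded below by `v`. -/
def SuppIn {x : P} (d : Fin n → ℤ) (v : Pmx P n y x → ℤ) (g : Gx K P n y x) : Prop :=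
  ∀ p, g.coeff p ≠ 0 → gdeg P n y x p = d ∧ ∀ w, v w ≤ p.2 w

lemma SuppIn.zero {x : P} (d : Fin n → ℤ) (v : Pmx P n y x → ℤ) :
    SuppIn d v (0 : Gx K P n y x) := by
  intro p hp; simp at hp

lemma SuppIn.single {x : P} (p : EIdx P n y x) {v : Pmx P n y x → ℤ} (c : K)
    (hv : ∀ w, v w ≤ p.2 w) :
    SuppIn (gdeg P n y x p) v (AddMonoidAlgebra.single p c) := by
  intro q hq
  rw [AddMonoidAlgebra.coeff_single, Finsupp.single_apply] at hq
  split_ifs at hq with h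
  · subst h; exact ⟨rfl, hv⟩
  · exact absurd rfl hq

lemma SuppIn.one {x : P} : SuppIn 0 0 (1 : Gx K P n y x) := by
  rw [AddMonoidAlgebra.one_def, ← gdeg_zero (y := y) x]
  exact .single 0 1 fun w => le_rfl

lemma SuppIn.add {x : P} {d : Fin n → ℤ} {v : Pmx P n y x → ℤ} {f g : Gx K P n y x}
    (hf : SuppIn d v f) (hg : SuppIn d v g) : SuppIn d v (f + g) := by
  intro p hp
  by_cases h : f.coeff p = 0
  · exact hg p fun h' => hp (by simp [h, h'])
  · exact hf p h

lemma SuppIn.sub {x : P} {d : Fin n → ℤ} {v : Pmx P n y x → ℤ} {f g : Gx K P n y x}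
    (hf : SuppIn d v f) (hg : SuppIn d v g) : SuppIn d v (f - g) := by
  intro p hp
  by_cases h : f.coeff p = 0
  · exact hg p fun h' => hp (by simp [h, h'])
  · exact hf p h

lemma SuppIn.mul {x : P} {d e : Fin n → ℤ} {v u : Pmx P n y x → ℤ} {f g : Gx K P n y x}
    (hf : SuppIn d v f) (hg : SuppIn e u g) : SuppIn (d + e) (v + u) (f * g) := by
  intro p hp
  obtain ⟨a, b, ha, hb, rfl⟩ := coeff_mul_ne_zero hp
  obtain ⟨ha, ha'⟩ := hf a ha
  obtain ⟨hb, hb'⟩ := hg b hb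
  exact ⟨by rw [gdeg_add, ha, hb], fun w => add_le_add (ha' w) (hb' w)⟩

lemma SuppIn.pow {x : P} {d : Fin n → ℤ} {v : Pmx P n y x → ℤ} {f : Gx K P n y x}
    (hf : SuppIn d v f) (k : ℕ) : SuppIn (k • d) (k • v) (f ^ k) := by
  induction k with
  | zero => simpa using SuppIn.one
  | succ k ih => rw [pow_succ, succ_nsmul, succ_nsmul]; exact ih.mul hf

lemma SuppIn.prod {x : P} {ι : Type*} (s : Finset ι) {d : ι → Fin n → ℤ}
    {v : ι → Pmx P n y x → ℤ} {f : ι → Gx K P n y x} (hf : ∀ i, SuppIn (d i) (v i) (f i)) :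
    SuppIn (∑ i ∈ s, d i) (∑ i ∈ s, v i) (∏ i ∈ s, f i) := by
  induction s using Finset.induction_on with
  | empty => simpa using SuppIn.one
  | insert a s ha ih =>
    rw [Finset.sum_insert ha, Finset.sum_insert ha, Finset.prod_insert ha]
    exact (hf a).mul ih

lemma gdeg_dvec {x w : P} (hw : w ≤ x) :
    gdeg P n y x (dvec P n y x w, 0) = fun i => if y i ≤ w then 1 else 0 := by
  funext i
  simp only [gdeg, dvec, Finsupp.sum_zero_index, add_zero, Finsupp.equivFunOnFinite_symm_apply_apply]
  split_ifs with h1 h2 h2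
  · rfl
  · rfl
  · exact absurd (h2.trans hw) h1
  · rfl

lemma gdeg_single {x : P} (w : Pmx P n y x) :
    gdeg P n y x (0, Finsupp.single w 1) = fun i => if y i ≤ w.1 then 1 else 0 := by
  funext i
  simp [gdeg]

lemma theta_X (x : P) (w : Pstar P) :
    theta K P n y x (X w) =
      (if w.1 ≤ x then AddMonoidAlgebra.single (dvec P n y x w.1, 0) 1 else 0) +
      (if h : ∃ i : Fin n, y i ≤ x ∧ y i = w.1 then 0
       else AddMonoidAlgebra.single
        ((0 : BelowIx P n y x →₀ ℤ), Finsupp.single (⟨w.1, w.2, h⟩ : Pmx P n y x) (1 : ℤ)) 1) := by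
  rw [theta, aeval_X]

lemma theta_X_of_mem (x : P) (w : Pmx P n y x) :
    theta K P n y x (X ⟨w.1, w.2.1⟩) =
      (if w.1 ≤ x then AddMonoidAlgebra.single (dvec P n y x w.1, 0) 1 else 0) +
      AddMonoidAlgebra.single ((0 : BelowIx P n y x →₀ ℤ), Finsupp.single w (1 : ℤ)) 1 := by
  rw [theta_X, dif_neg w.2.2]

lemma theta_X_of_notMem (x : P) (w : Pstar P) (h : ∃ i : Fin n, y i ≤ x ∧ y i = w.1) :
    theta K P n y x (X w) = AddMonoidAlgebra.single (dvec P n y x w.1, 0) 1 := by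
  have hw : w.1 ≤ x := by obtain ⟨i, hi, h⟩ := h; exact h ▸ hi
  rw [theta_X, dif_pos h, if_pos hw, add_zero]

lemma suppIn_single_dvec {x w : P} (hw : w ≤ x) :
    SuppIn (fun i => if y i ≤ w then 1 else 0) 0
      (AddMonoidAlgebra.single (dvec P n y x w, 0) 1 : Gx K P n y x) := by
  rw [← gdeg_dvec hw]
  exact .single _ _ fun w => le_rfl

lemma suppIn_theta_X (x : P) (w : Pstar P) :
    SuppIn (tdeg P n y w) 0 (theta K P n y x (X w)) := by
  rw [theta_X]
  refine .add ?_ ?_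
  · split_ifs with h
    · exact suppIn_single_dvec h
    · exact .zero _ _
  · split_ifs with h
    · exact .zero _ _
    · have := SuppIn.single (y := y) (K := K)
        (0, Finsupp.single (⟨w.1, w.2, h⟩ : Pmx P n y x) (1 : ℤ)) (v := 0) 1
        (fun u => by simp [Finsupp.single_apply]; split_ifs <;> simp)
      rwa [gdeg_single] at this

lemma theta_coeff_ne_zero {x : P} (s : FaceS K P) {p : EIdx P n y x}
    (hp : (theta K P n y x s).coeff p ≠ 0) (w : Pmx P n y x) : 0 ≤ p.2 w := by
  induction s using MvPolynomial.induction_on generalizing p with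
  | C a =>
    rw [← MvPolynomial.algebraMap_eq, AlgHom.commutes, Algebra.algebraMap_eq_smul_one] at hp
    refine (SuppIn.one (K := K) p fun h => hp ?_).2 w
    rw [AddMonoidAlgebra.coeff_smul_apply, h, smul_zero]
  | add f g hf hg =>
    by_cases h : (theta K P n y x f).coeff p = 0
    · exact hg fun h' => hp (by simp [h, h'])
    · exact hf h
  | mul_X f u hf =>
    rw [map_mul] at hp
    obtain ⟨a, b, ha, hb, rfl⟩ := coeff_mul_ne_zero hp
    exact add_nonneg (hf ha) ((suppIn_theta_X x u b hb).2 w)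

lemma smul_def (x : P) (s : FaceS K P) (g : Gx K P n y x) :
    s • g = theta K P n y x s * g := rfl

lemma mem_Ux_iff {x : P} {g : Gx K P n y x} :
    g ∈ Ux K P n y x ↔ ∀ p : EIdx P n y x, (∀ w, p.2 w ≤ 0) → g.coeff p = 0 := by
  constructor
  · intro hg
    induction hg using Submodule.span_induction with
    | mem g hg =>
      obtain ⟨q, ⟨w, hw⟩, rfl⟩ := hg
      intro p hp
      rw [AddMonoidAlgebra.coeff_single, Finsupp.single_apply, if_neg]
      rintro rfl
      exact absurd (hp w) (not_le.2 hw)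
    | zero => intros; rfl
    | add f g _ _ hf hg => intro p hp; simp [hf p hp, hg p hp]
    | smul s g _ hg =>
      intro p hp
      rw [smul_def]
      by_contra h
      obtain ⟨a, b, ha, hb, rfl⟩ := coeff_mul_ne_zero h
      refine hb (hg b fun w => ?_)
      have h1 := theta_coeff_ne_zero s ha w
      have h2 : a.2 w + b.2 w ≤ 0 := hp w
      lia
  · intro h
    rw [← AddMonoidAlgebra.sum_coeff_single g]
    refine Submodule.sum_mem _ fun p hp => ?_
    have hp' : ∃ w, 0 < p.2 w := by
      by_contra! hc
      exact Finsupp.mem_support_iff.1 hp (h p hc)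
    have h1 : (AddMonoidAlgebra.single p (g.coeff p) : Gx K P n y x) =
        (C (g.coeff p) : FaceS K P) • AddMonoidAlgebra.single p 1 := by
      rw [smul_def, ← MvPolynomial.algebraMap_eq, AlgHom.commutes, ← Algebra.smul_def,
        AddMonoidAlgebra.smul_single, smul_eq_mul, mul_one]
    rw [h1]
    exact Submodule.smul_mem _ _ (Submodule.subset_span ⟨p, hp', rfl⟩)

lemma mk_mem_ExGrade {x : P} {d : Fin n → ℤ} {g : Gx K P n y x}
    (hg : ∀ p, g.coeff p ≠ 0 → gdeg P n y x p = d) :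
    (Submodule.Quotient.mk g : ExMod K P n y x) ∈ ExGrade K P n y x d := by
  have h1 : (Submodule.Quotient.mk g : ExMod K P n y x) =
      ∑ p ∈ g.coeff.support, g.coeff p •
        (Submodule.Quotient.mk (AddMonoidAlgebra.single p 1) : ExMod K P n y x) := by
    conv_lhs => rw [← AddMonoidAlgebra.sum_coeff_single g, Finsupp.sum]
    rw [← Submodule.mkQ_apply, map_sum]
    refine Finset.sum_congr rfl fun p _ => ?_
    rw [Submodule.mkQ_apply, ← Submodule.Quotient.mk_smul, AddMonoidAlgebra.smul_single,
      smul_eq_mul, mul_one]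
  rw [h1]
  exact Submodule.sum_mem _ fun p hp => Submodule.smul_mem _ _
    (Submodule.subset_span ⟨p, hg p (Finsupp.mem_support_iff.1 hp), rfl⟩)

/-- A degree preserving homomorphism may be checked on monomials. -/
lemma degZero_of_monomial {x z : P} (φ : ExMod K P n y x →ₗ[FaceS K P] ExMod K P n y z)
    (h : ∀ p, φ (Submodule.Quotient.mk (AddMonoidAlgebra.single p 1)) ∈
      ExGrade K P n y z (gdeg P n y x p)) : DegZero K P n y x z φ := by
  intro d e he
  induction he using Submodule.span_induction with
  | mem e he => obtain ⟨p, rfl, rfl⟩ := he; exact h p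
  | zero => rw [map_zero]; exact Submodule.zero_mem _
  | add e f _ _ he hf => rw [map_add]; exact Submodule.add_mem _ he hf
  | smul c e _ he =>
    rw [LinearMap.map_smul_of_tower φ c e]
    exact Submodule.smul_mem _ _ he

end GradedSupport

section Projection

/-- Extension by zero of exponent vectors on the atoms below `z` to the atoms below `x`. -/
def atomExt (x z : P) : (BelowIx P n y z →₀ ℤ) →+ (BelowIx P n y x →₀ ℤ) where
  toFun a := Finsupp.equivFunOnFinite.symm fun i => if h : y i.1 ≤ z then a ⟨i.1, h⟩ else 0
  map_zero' := by ext i; simp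
  map_add' a b := by ext i; simp; split_ifs <;> simp

/-- The image `π_z(t_w)`, as an element of the Laurent algebra of `x`. -/
def laurentPart (x z : P) (w : Pstar P) : Gx K P n y x :=
  if w.1 ≤ z then AddMonoidAlgebra.single (dvec P n y x w.1, 0) 1 else 0

/-- The action of `t_w - π_z(t_w)` on the Laurent algebra of `x`. -/
def shiftedVar (x z : P) (w : Pstar P) : Gx K P n y x :=
  theta K P n y x (X w) - laurentPart K P n y x z w

/-- The element of the Laurent algebra of `x` corresponding to the inverse of the monomial of
`*E_z` with index `q`. -/
def dualMul (x z : P) (q : EIdx P n y z) : Gx K P n y x :=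
  AddMonoidAlgebra.single (atomExt P n y x z (-q.1), 0) 1 *
    ∏ w : Pmx P n y z, shiftedVar K P n y x z ⟨w.1, w.2.1⟩ ^ (-q.2 w).toNat

variable {K P n y}

lemma gdeg_atomExt {x z : P} (hzx : z ≤ x) (a : BelowIx P n y z →₀ ℤ) :
    gdeg P n y x (atomExt P n y x z a, 0) = gdeg P n y z (a, 0) := by
  funext i
  simp only [gdeg, atomExt, Finsupp.sum_zero_index, add_zero, AddMonoidHom.coe_mk, ZeroHom.coe_mk,
    Finsupp.equivFunOnFinite_symm_apply_apply]
  by_cases h : y i ≤ z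
  · simp [h, h.trans hzx]
  · simp [h]

lemma atomExt_dvec {x z w : P} (hw : w ≤ z) :
    atomExt P n y x z (dvec P n y z w) = dvec P n y x w := by
  ext i
  simp only [atomExt, dvec, AddMonoidHom.coe_mk, ZeroHom.coe_mk,
    Finsupp.equivFunOnFinite_symm_apply_apply]
  split_ifs with h1 h2 h2
  · rfl
  · rfl
  · exact absurd (h2.trans hw) h1
  · rfl

lemma shiftedVar_eq_zero {x z : P} (hzx : z ≤ x) (w : Pstar P)
    (h : ∃ i : Fin n, y i ≤ z ∧ y i = w.1) : shiftedVar K P n y x z w = 0 := by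
  obtain ⟨i, hi, h⟩ := h
  rw [shiftedVar, theta_X_of_notMem x w ⟨i, hi.trans hzx, h⟩, laurentPart, if_pos (h ▸ hi),
    sub_self]

lemma suppIn_shiftedVar {x z : P} (hzx : z ≤ x) (w : Pmx P n y z) :
    SuppIn (fun i => if y i ≤ w.1 then 1 else 0)
      (fun u : Pmx P n y x => if u.1 = w.1 ∧ (w.1 ≤ z ∨ ¬ w.1 ≤ x) then 1 else 0)
      (shiftedVar K P n y x z ⟨w.1, w.2.1⟩) := by
  by_cases hw : w.1 ≤ z ∨ ¬ w.1 ≤ x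
  · have hn : ¬ ∃ i : Fin n, y i ≤ x ∧ y i = w.1 := by
      rintro ⟨i, hi, h⟩
      rcases hw with hw | hw
      · exact w.2.2 ⟨i, h ▸ hw, h⟩
      · exact hw (h ▸ hi)
    have h1 := theta_X_of_mem (K := K) x (⟨w.1, w.2.1, hn⟩ : Pmx P n y x)
    have h2 : shiftedVar K P n y x z ⟨w.1, w.2.1⟩ = AddMonoidAlgebra.single
        ((0 : BelowIx P n y x →₀ ℤ), Finsupp.single (⟨w.1, w.2.1, hn⟩ : Pmx P n y x) (1 : ℤ)) 1 := by
      rw [shiftedVar, h1, laurentPart]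
      by_cases hz : w.1 ≤ z
      · simp [hz, hz.trans hzx]
      · have hx : ¬ w.1 ≤ x := hw.resolve_left hz
        simp [hz, hx]
    have h3 := SuppIn.single (y := y) (K := K)
      (0, Finsupp.single (⟨w.1, w.2.1, hn⟩ : Pmx P n y x) (1 : ℤ))
      (v := fun u : Pmx P n y x => if u.1 = w.1 ∧ (w.1 ≤ z ∨ ¬ w.1 ≤ x) then 1 else 0) 1
      (fun u => by
        simp only [hw, and_true, Finsupp.single_apply, Subtype.ext_iff, eq_comm]
        exact le_rfl)
    rw [gdeg_single] at h3
    rw [h2]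
    exact h3
  · simp only [hw, and_false, if_false]
    refine .sub (suppIn_theta_X x _) ?_
    rw [laurentPart]
    split_ifs with h
    · exact suppIn_single_dvec (h.trans hzx)
    · exact .zero _ _

lemma gdeg_snd {z : P} (b : Pmx P n y z →₀ ℤ) :
    gdeg P n y z (0, b) = ∑ w, b w • (fun i => if y i ≤ w.1 then (1 : ℤ) else 0) := by
  funext i
  simp [gdeg_apply]

lemma dualMul_coeff_ne_zero {x z : P} (hzx : z ≤ x) {q : EIdx P n y z} (hq : ∀ w, q.2 w ≤ 0)
    {p : EIdx P n y x} (hp : (dualMul K P n y x z q).coeff p ≠ 0) :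
    gdeg P n y x p = -gdeg P n y z q ∧ (∀ u, 0 ≤ p.2 u) ∧
    ∀ (w : Pmx P n y z) (u : Pmx P n y x), u.1 = w.1 → (w.1 ≤ z ∨ ¬ w.1 ≤ x) →
      -q.2 w ≤ p.2 u := by
  have h1 := SuppIn.prod (Finset.univ : Finset (Pmx P n y z)) (fun w =>
    (suppIn_shiftedVar (K := K) hzx w).pow (-q.2 w).toNat)
  have h2 := SuppIn.single (y := y) (K := K) (x := x) (atomExt P n y x z (-q.1), 0) (v := 0) 1
    (fun w => le_rfl)
  obtain ⟨hd, hv⟩ := h2.mul h1 p hp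
  have hnn : ∀ (w : Pmx P n y z) (u : Pmx P n y x), 0 ≤ ((-q.2 w).toNat •
      (fun u : Pmx P n y x => if u.1 = w.1 ∧ (w.1 ≤ z ∨ ¬ w.1 ≤ x) then (1 : ℤ) else 0)) u := by
    intro w u
    refine nsmul_nonneg ?_ _
    dsimp only
    split_ifs <;> simp
  refine ⟨?_, fun u => ?_, fun w u huw hw => ?_⟩
  · rw [hd, gdeg_atomExt hzx, ← gdeg_neg]
    have : -q = (-q.1, 0) + (0, -q.2) := by ext <;> simp
    rw [this, gdeg_add, gdeg_snd]
    congr 1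
    refine Finset.sum_congr rfl fun w _ => ?_
    rw [← natCast_zsmul, Int.toNat_of_nonneg (by have := hq w; lia)]
    rfl
  · refine le_trans ?_ (hv u)
    rw [Pi.add_apply, Finset.sum_apply]
    exact add_nonneg le_rfl (Finset.sum_nonneg fun w _ => hnn w u)
  · refine le_trans ?_ (hv u)
    rw [Pi.add_apply, Finset.sum_apply, Pi.zero_apply, zero_add]
    refine le_trans ?_ (Finset.single_le_sum (fun w _ => hnn w u) (Finset.mem_univ w))
    simp [huw, hw]

lemma exists_atom_le_not_le (hP : IsSimplicialPoset P) (hy : AtomEnum P n y) {x z w : P}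
    (hzx : z ≤ x) (hwx : w ≤ x) (hwz : ¬ w ≤ z) : ∃ i, y i ≤ w ∧ ¬ y i ≤ z := by
  obtain ⟨m, ⟨e⟩⟩ := hP x
  have h1 : ¬ e ⟨w, hwx⟩ ≤ e ⟨z, hzx⟩ := fun h => hwz (e.le_iff_le.1 h)
  obtain ⟨j, hjw, hjz⟩ := Finset.not_subset.1 h1
  obtain ⟨⟨a, hax⟩, ha⟩ := e.surjective {j}
  have haw : a ≤ w := by
    have : (⟨a, hax⟩ : Set.Iic x) ≤ ⟨w, hwx⟩ := by
      rw [← e.le_iff_le, ha]; exact Finset.singleton_subset_iff.2 hjw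
    exact this
  have haz : ¬ a ≤ z := by
    intro h
    have h' : (⟨a, hax⟩ : Set.Iic x) ≤ ⟨z, hzx⟩ := h
    rw [← e.le_iff_le, ha] at h'
    exact hjz (Finset.singleton_subset_iff.1 h')
  have hatom : IsAtom a := by
    refine ⟨?_, fun b hb => ?_⟩
    · rintro rfl; exact haz bot_le
    · have hb' : e ⟨b, hb.le.trans hax⟩ < {j} := by
        rw [← ha]; exact e.lt_iff_lt.2 hb
      have hb0 : e ⟨b, hb.le.trans hax⟩ = ∅ := by
        simpa using Finset.ssubset_singleton_iff.1 hb'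
      have : (⟨b, hb.le.trans hax⟩ : Set.Iic x) ≤ ⟨⊥, bot_le⟩ := by
        rw [← e.le_iff_le, hb0]; exact Finset.empty_subset _
      exact le_bot_iff.1 this
  obtain ⟨i, rfl⟩ := (hy.2 a).1 hatom
  exact ⟨i, haw, haz⟩

lemma finite_dualMul_support (hP : IsSimplicialPoset P) (hy : AtomEnum P n y) {x z : P}
    (hzx : z ≤ x) (p : EIdx P n y x) :
    {q : EIdx P n y z | (∀ w, q.2 w ≤ 0) ∧ (dualMul K P n y x z q).coeff (-p) ≠ 0}.Finite := by
  have hbound : ∀ w : Pmx P n y z, ∃ L : ℤ, ∀ q : EIdx P n y z, (∀ w, q.2 w ≤ 0) →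
      (dualMul K P n y x z q).coeff (-p) ≠ 0 → L ≤ q.2 w := by
    intro w
    by_cases hw : w.1 ≤ z ∨ ¬ w.1 ≤ x
    · have hn : ¬ ∃ i : Fin n, y i ≤ x ∧ y i = w.1 := by
        rintro ⟨i, hi, h⟩
        rcases hw with hw | hw
        · exact w.2.2 ⟨i, h ▸ hw, h⟩
        · exact hw (h ▸ hi)
      refine ⟨p.2 ⟨w.1, w.2.1, hn⟩, fun q hq h => ?_⟩
      have := (dualMul_coeff_ne_zero hzx hq h).2.2 w ⟨w.1, w.2.1, hn⟩ rfl hw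
      rw [Prod.snd_neg, Finsupp.neg_apply] at this
      lia
    · push Not at hw
      obtain ⟨i, hiw, hiz⟩ := exists_atom_le_not_le hP hy hzx hw.2 hw.1
      refine ⟨gdeg P n y x p i, fun q hq h => ?_⟩
      have h1 := (dualMul_coeff_ne_zero hzx hq h).1
      rw [gdeg_neg, neg_inj] at h1
      rw [h1, gdeg_apply, dif_neg hiz, zero_add, ← Finset.add_sum_erase _ _ (Finset.mem_univ w),
        if_pos hiw, mul_one, add_le_iff_nonpos_right]
      refine Finset.sum_nonpos fun u _ => ?_
      have := hq u
      split_ifs <;> lia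
  choose L hL using hbound
  refine Set.Finite.of_finite_image (f := Prod.snd)
    ((Set.finite_Icc (Finsupp.equivFunOnFinite.symm L) 0).subset ?_) ?_
  · rintro _ ⟨q, ⟨hq, h⟩, rfl⟩
    exact ⟨fun w => hL w q hq h, fun w => hq w⟩
  · rintro q ⟨hq, h⟩ q' ⟨hq', h'⟩ heq
    refine Prod.ext ?_ heq
    have h1 := (dualMul_coeff_ne_zero hzx hq h).1
    rw [(dualMul_coeff_ne_zero hzx hq' h').1, neg_inj] at h1
    ext ⟨i, hi⟩
    have h2 := congrFun h1 i
    rw [gdeg_apply, gdeg_apply, dif_pos hi, dif_pos hi,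
      show q.2 = q'.2 from heq] at h2
    lia

lemma finite_pairing_support (hP : IsSimplicialPoset P) (hy : AtomEnum P n y) {x z : P}
    (hzx : z ≤ x) (g : Gx K P n y x) :
    (Function.support fun q : EIdx P n y z =>
      if ∀ w, q.2 w ≤ 0 then (dualMul K P n y x z q * g).coeff 0 else 0).Finite := by
  refine ((g.coeff.support.finite_toSet).biUnion fun p _ =>
    finite_dualMul_support (K := K) hP hy hzx p).subset ?_
  intro q hq
  rw [Function.mem_support] at hq
  split_ifs at hq with h
  · obtain ⟨a, b, ha, hb, hab⟩ := coeff_mul_ne_zero hq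
    rw [← eq_neg_iff_add_eq_zero] at hab
    simp only [Set.mem_iUnion]
    exact ⟨b, Finsupp.mem_support_iff.2 hb, h, hab ▸ ha⟩
  · exact absurd rfl hq

/-- The linear map whose coefficient at `q` is the pairing of `dualMul q` with the argument. -/
def pairingMap (hP : IsSimplicialPoset P) (hy : AtomEnum P n y) {x z : P}
    (hzx : z ≤ x) : Gx K P n y x →+ Gx K P n y z where
  toFun g := .ofCoeff (Finsupp.ofSupportFinite _ (finite_pairing_support hP hy hzx g))
  map_zero' := by
    ext q
    simp [Finsupp.ofSupportFinite_coe]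
  map_add' f g := by
    ext q
    simp only [Finsupp.ofSupportFinite_coe, AddMonoidAlgebra.coeff_add, Finsupp.add_apply, mul_add]
    split_ifs <;> simp

lemma pairingMap_coeff (hP : IsSimplicialPoset P) (hy : AtomEnum P n y) {x z : P}
    (hzx : z ≤ x) (g : Gx K P n y x) (q : EIdx P n y z) :
    (pairingMap hP hy hzx g).coeff q =
      if ∀ w, q.2 w ≤ 0 then (dualMul K P n y x z q * g).coeff 0 else 0 := rfl

lemma pairingMap_C (hP : IsSimplicialPoset P) (hy : AtomEnum P n y) {x z : P}
    (hzx : z ≤ x) (c : K) (g : Gx K P n y x) :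
    pairingMap hP hy hzx ((C c : FaceS K P) • g) = (C c : FaceS K P) • pairingMap hP hy hzx g := by
  ext q
  simp only [smul_def, ← MvPolynomial.algebraMap_eq, AlgHom.commutes, ← Algebra.smul_def,
    pairingMap_coeff, AddMonoidAlgebra.coeff_smul_apply, mul_smul_comm, smul_eq_mul]
  split_ifs <;> simp

lemma dualMul_sub_dvec {x z : P} (w : Pstar P) (hw : w.1 ≤ z)
    (q : EIdx P n y z) :
    dualMul K P n y x z (q - (dvec P n y z w.1, 0)) =
      laurentPart K P n y x z w * dualMul K P n y x z q := by
  rw [laurentPart, if_pos hw, dualMul, dualMul, ← mul_assoc, AddMonoidAlgebra.single_mul_single,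
    mul_one, Prod.mk_add_mk, ← atomExt_dvec (x := x) hw, ← map_add, add_zero, Prod.fst_sub, Prod.snd_sub,
    sub_zero, neg_sub, sub_eq_add_neg]

lemma dualMul_sub_single {x z : P} (w : Pmx P n y z) {q : EIdx P n y z} (hq : q.2 w ≤ 0) :
    dualMul K P n y x z (q - (0, Finsupp.single w 1)) =
      shiftedVar K P n y x z ⟨w.1, w.2.1⟩ * dualMul K P n y x z q := by
  rw [dualMul, dualMul, Prod.fst_sub, sub_zero, mul_left_comm]
  congr 1
  rw [← Finset.mul_prod_erase _ _ (Finset.mem_univ w), ← Finset.mul_prod_erase _ _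
    (Finset.mem_univ w), ← mul_assoc, ← pow_succ']
  congr 1
  · congr 1
    simp
    lia
  · refine Finset.prod_congr rfl fun u hu => ?_
    rw [Prod.snd_sub, Finsupp.sub_apply, Finsupp.single_eq_of_ne (Finset.ne_of_mem_erase hu),
      sub_zero]

lemma pairingMap_X (hP : IsSimplicialPoset P) (hy : AtomEnum P n y) {x z : P}
    (hzx : z ≤ x) (w : Pstar P) (g : Gx K P n y x) :
    pairingMap hP hy hzx ((X w : FaceS K P) • g) - (X w : FaceS K P) • pairingMap hP hy hzx g ∈
      Ux K P n y z := by
  rw [mem_Ux_iff]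
  intro q hq
  rw [AddMonoidAlgebra.coeff_sub, Finsupp.sub_apply, sub_eq_zero, pairingMap_coeff, if_pos hq,
    smul_def, smul_def, theta_X (x := z), add_mul, AddMonoidAlgebra.coeff_add, Finsupp.add_apply]
  have h1 : ((if w.1 ≤ z then AddMonoidAlgebra.single (dvec P n y z w.1, 0) 1 else 0) *
      pairingMap hP hy hzx g).coeff q =
      ((laurentPart K P n y x z w * dualMul K P n y x z q) * g).coeff 0 := by
    split_ifs with hw
    · rw [AddMonoidAlgebra.coeff_single_mul_apply, one_mul, neg_add_eq_sub, pairingMap_coeff,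
        if_pos (by simpa using hq), dualMul_sub_dvec w hw]
    · simp [laurentPart, hw]
  have h2 : ((if h : ∃ i : Fin n, y i ≤ z ∧ y i = w.1 then 0
       else AddMonoidAlgebra.single
        ((0 : BelowIx P n y z →₀ ℤ), Finsupp.single (⟨w.1, w.2, h⟩ : Pmx P n y z) (1 : ℤ)) 1) *
      pairingMap hP hy hzx g).coeff q =
      ((shiftedVar K P n y x z w * dualMul K P n y x z q) * g).coeff 0 := by
    split_ifs with hw
    · simp [shiftedVar_eq_zero hzx w hw]
    · rw [AddMonoidAlgebra.coeff_single_mul_apply, one_mul, neg_add_eq_sub, pairingMap_coeff,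
        if_pos, dualMul_sub_single _ (hq _)]
      intro u
      have := hq u
      simp only [Prod.snd_sub, Finsupp.sub_apply, Finsupp.single_apply]
      split_ifs <;> lia
  rw [h1, h2, ← Finsupp.add_apply, ← AddMonoidAlgebra.coeff_add, ← add_mul, ← add_mul, shiftedVar,
    add_sub_cancel, ← mul_assoc, mul_comm (dualMul K P n y x z q)]

lemma pairingMap_smul (hP : IsSimplicialPoset P) (hy : AtomEnum P n y) {x z : P}
    (hzx : z ≤ x) (s : FaceS K P) (g : Gx K P n y x) :
    (Ux K P n y z).mkQ (pairingMap hP hy hzx (s • g)) =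
      s • (Ux K P n y z).mkQ (pairingMap hP hy hzx g) := by
  induction s using MvPolynomial.induction_on generalizing g with
  | C c => rw [pairingMap_C, map_smul]
  | add f h hf hh => rw [add_smul, map_add, map_add, hf, hh, add_smul]
  | mul_X f w hf =>
    rw [mul_smul, hf, mul_smul, ← map_smul _ (X w)]
    congr 1
    exact (Submodule.Quotient.eq _).2 (pairingMap_X hP hy hzx w g)

lemma pairingMap_single_coeff_ne_zero (hP : IsSimplicialPoset P) (hy : AtomEnum P n y) {x z : P}
    (hzx : z ≤ x) (p : EIdx P n y x) (q : EIdx P n y z)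
    (h : (pairingMap hP hy hzx (AddMonoidAlgebra.single p (1 : K))).coeff q ≠ 0) :
    gdeg P n y z q = gdeg P n y x p ∧ ∀ w, p.2 w ≤ 0 := by
  rw [pairingMap_coeff] at h
  split_ifs at h with hq
  · rw [AddMonoidAlgebra.coeff_mul_single_apply, mul_one, zero_add] at h
    obtain ⟨h1, h2, -⟩ := dualMul_coeff_ne_zero hzx hq h
    rw [gdeg_neg, neg_inj] at h1
    exact ⟨h1.symm, fun w => by simpa using h2 w⟩
  · exact absurd rfl h

/-- The homomorphism `*E_x → *E_z` extending the projection `S_x → S_z`. -/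
def projHom (hP : IsSimplicialPoset P) (hy : AtomEnum P n y) {x z : P}
    (hzx : z ≤ x) : ExMod K P n y x →ₗ[FaceS K P] ExMod K P n y z :=
  (Ux K P n y x).liftQ
    { toFun g := (Ux K P n y z).mkQ (pairingMap hP hy hzx g)
      map_add' f g := by rw [map_add, map_add]
      map_smul' s g := pairingMap_smul hP hy hzx s g } <| by
    refine Submodule.span_le.2 ?_
    rintro _ ⟨p, ⟨w, hw⟩, rfl⟩
    refine (Submodule.Quotient.mk_eq_zero _).2 ?_
    convert Submodule.zero_mem _
    ext q
    by_contra h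
    exact absurd ((pairingMap_single_coeff_ne_zero hP hy hzx p q h).2 w) (not_le.2 hw)

lemma projHom_mk (hP : IsSimplicialPoset P) (hy : AtomEnum P n y) {x z : P}
    (hzx : z ≤ x) (g : Gx K P n y x) :
    projHom hP hy hzx (Submodule.Quotient.mk g) =
      Submodule.Quotient.mk (pairingMap hP hy hzx g) := rfl

lemma degZero_projHom (hP : IsSimplicialPoset P) (hy : AtomEnum P n y) {x z : P}
    (hzx : z ≤ x) : DegZero K P n y x z (projHom hP hy hzx) :=
  degZero_of_monomial _ fun p => by
    rw [projHom_mk]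
    exact mk_mem_ExGrade fun q hq => (pairingMap_single_coeff_ne_zero hP hy hzx p q hq).1

lemma onex_eq (x : P) : onex K P n y x = Submodule.Quotient.mk 1 := by
  rw [onex, emono, AddMonoidAlgebra.one_def]
  simp [mIdx, ← Prod.zero_eq_mk]

lemma projHom_onex (hP : IsSimplicialPoset P) (hy : AtomEnum P n y) {x z : P}
    (hzx : z ≤ x) : projHom hP hy hzx (onex K P n y x) ≠ 0 := by
  rw [onex_eq, projHom_mk, Ne, Submodule.Quotient.mk_eq_zero, mem_Ux_iff]
  intro h
  have := h 0 (by simp)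
  rw [pairingMap_coeff, if_pos (by simp)] at this
  simp [dualMul, AddMonoidAlgebra.one_def, ← Prod.zero_eq_mk] at this

end Projection

section Shift

variable {K P n y}

lemma not_atom_of_two_le_prank (hy : AtomEnum P n y) {x : P} (hrk : 2 ≤ prank P n y x) :
    x ≠ ⊥ ∧ ¬ ∃ i : Fin n, y i ≤ x ∧ y i = x := by
  obtain ⟨i, hi, j, hj, hij⟩ := Finset.one_lt_card.1 (show 1 < prank P n y x from hrk)
  simp only [Finset.mem_filter, Finset.mem_univ, true_and] at hi hj
  have hatom : ∀ k, IsAtom (y k) := fun k => (hy.2 _).2 ⟨k, rfl⟩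
  refine ⟨?_, ?_⟩
  · rintro rfl
    exact (hatom i).1 (le_bot_iff.1 hi)
  · rintro ⟨k, -, rfl⟩
    have h : ∀ l, y l ≤ y k → l = k := fun l hl =>
      hy.1 (((hatom k).le_iff.1 hl).resolve_left (hatom l).1)
    exact hij ((h i hi).trans (h j hj).symm)

/-- The exponent of `∏ t_i^{-1} ⊗ t_x`. -/
def shiftIdx {x : P} (w : Pmx P n y x) : EIdx P n y x :=
  (-dvec P n y x w.1, Finsupp.single w 1)

lemma gdeg_shiftIdx {x : P} (w : Pmx P n y x) (hw : w.1 ≤ x) :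
    gdeg P n y x (shiftIdx w) = 0 := by
  have : shiftIdx w = -(dvec P n y x w.1, 0) + (0, Finsupp.single w 1) := by
    ext <;> simp [shiftIdx]
  rw [this, gdeg_add, gdeg_neg, gdeg_dvec hw, gdeg_single, neg_add_cancel]

/-- Multiplication by `∏ t_i^{-1} ⊗ t_x` as an endomorphism of `*E_x`. -/
def shiftHom {x : P} (w : Pmx P n y x) : ExMod K P n y x →ₗ[FaceS K P] ExMod K P n y x :=
  (Ux K P n y x).mapQ (Ux K P n y x)
    { toFun g := AddMonoidAlgebra.single (shiftIdx w) 1 * g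
      map_add' f g := mul_add _ f g
      map_smul' s g := mul_left_comm _ (theta K P n y x s) g } <| by
    intro g hg
    rw [mem_Ux_iff] at hg
    rw [Submodule.mem_comap, mem_Ux_iff]
    intro p hp
    change (AddMonoidAlgebra.single (shiftIdx w) 1 * g).coeff p = 0
    rw [AddMonoidAlgebra.coeff_single_mul_apply, one_mul]
    refine hg _ fun u => ?_
    have := hp u
    simp only [shiftIdx, Prod.snd_add, Prod.snd_neg, Finsupp.add_apply, Finsupp.neg_apply,
      Finsupp.single_apply]
    split_ifs <;> lia

lemma shiftHom_mk {x : P} (w : Pmx P n y x) (g : Gx K P n y x) :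
    shiftHom w (Submodule.Quotient.mk g) =
      Submodule.Quotient.mk (AddMonoidAlgebra.single (shiftIdx w) 1 * g) := rfl

lemma shiftHom_surjective {x : P} (w : Pmx P n y x) :
    Function.Surjective (shiftHom (K := K) w) := by
  intro e
  obtain ⟨g, rfl⟩ := Submodule.Quotient.mk_surjective _ e
  refine ⟨Submodule.Quotient.mk (AddMonoidAlgebra.single (-shiftIdx w) 1 * g), ?_⟩
  rw [shiftHom_mk, ← mul_assoc, AddMonoidAlgebra.single_mul_single, add_neg_cancel, mul_one,
    ← AddMonoidAlgebra.one_def, one_mul]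

lemma shiftHom_onex {x : P} (w : Pmx P n y x) : shiftHom w (onex K P n y x) = 0 := by
  rw [onex_eq, shiftHom_mk, mul_one, Submodule.Quotient.mk_eq_zero]
  exact Submodule.subset_span ⟨_, ⟨w, by simp [shiftIdx]⟩, rfl⟩

lemma degZero_shiftHom {x : P} (w : Pmx P n y x) (hw : w.1 ≤ x) :
    DegZero K P n y x x (shiftHom w) :=
  degZero_of_monomial _ fun p => by
    rw [shiftHom_mk, AddMonoidAlgebra.single_mul_single, mul_one]
    refine Submodule.subset_span ⟨_, ?_, rfl⟩
    rw [gdeg_add, gdeg_shiftIdx w hw, zero_add]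

lemma not_finite_degZeroSub {x z : P} {φ : ExMod K P n y x →ₗ[FaceS K P] ExMod K P n y z}
    (hφ : DegZero K P n y x z φ) (hφ1 : φ (onex K P n y x) ≠ 0)
    {ψ : ExMod K P n y x →ₗ[FaceS K P] ExMod K P n y x} (hψ : DegZero K P n y x x ψ)
    (hs : Function.Surjective ψ) (hψ1 : ψ (onex K P n y x) = 0) :
    ¬ Module.Finite K (degZeroSub K P n y x z) := by
  intro hfin
  let T : degZeroSub K P n y x z →ₗ[K] degZeroSub K P n y x z :=
    { toFun f := ⟨f.1.comp ψ, fun d e he => f.2 d _ (hψ d e he)⟩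
      map_add' f g := rfl
      map_smul' c f := rfl }
  have hT : Function.Injective T := by
    intro f g hfg
    ext1
    exact LinearMap.cancel_right hs |>.1 (congrArg Subtype.val hfg)
  have hT' : Function.Surjective T :=
    @LinearMap.surjective_of_injective K (degZeroSub K P n y x z) _ _ _ _ T hT
  obtain ⟨f, hf⟩ := hT' ⟨φ, hφ⟩
  refine hφ1 ?_
  have h1 : f.1.comp ψ = φ := congrArg Subtype.val hf
  rw [← h1, LinearMap.comp_apply, hψ1, map_zero]

end Shift

/-- Remark 3.2: if `z ≤ x` and `rank x ≥ 2`, there is a nonzero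
degree preserving homomorphism `φ : *E_x → *E_z` with `φ(1_x) = 0`; consequently
`[*Hom_S(*E_x, *E_z)]_0` is an infinite dimensional `K`-vector space. -/
theorem statement8
    (hP : IsSimplicialPoset P) (hy : AtomEnum P n y)
    (x z : P) (hzx : z ≤ x) (hrk : 2 ≤ prank P n y x) :
    (∃ φ : ExMod K P n y x →ₗ[FaceS K P] ExMod K P n y z,
      φ ≠ 0 ∧ DegZero K P n y x z φ ∧ φ (onex K P n y x) = 0) ∧
    ¬ Module.Finite K (degZeroSub K P n y x z) := by
  have hx := not_atom_of_two_le_prank hy hrk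
  let w : Pmx P n y x := ⟨x, hx⟩
  have hφ := degZero_projHom (K := K) hP hy hzx
  have hψ := degZero_shiftHom (K := K) w le_rfl
  refine ⟨⟨(projHom hP hy hzx).comp (shiftHom w), fun h => ?_, fun d e he => hφ d _ (hψ d e he), ?_⟩,
    not_finite_degZeroSub hφ (projHom_onex hP hy hzx) hψ (shiftHom_surjective w) (shiftHom_onex w)⟩
  · obtain ⟨e, he⟩ := shiftHom_surjective w (onex K P n y x)
    refine projHom_onex (K := K) hP hy hzx ?_
    rw [← he, ← LinearMap.comp_apply, h, LinearMap.zero_apply]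
  · rw [LinearMap.comp_apply, shiftHom_onex, map_zero]

end
end

section
/- Let x, z ∈ P and let ψ : *E_x → *E_z be a degree-preserving S-homomorphism. If ψ(α) ∈ L(*E_z) holds for every α in the Z^n-degree-0 part of L(*E_x), then ψ is clean. -/
open scoped Classical
open MvPolynomial

noncomputable section

variable (K : Type) [Field K]
variable (P : Type) [Fintype P] [PartialOrder P] [OrderBot P]

variable (n : ℕ) (y : Fin n → P)

section ProofLemmas

variable {K P n y}

/-- The exponent vector on the atoms below `x` obtained by restricting `d`. -/
def atomRestrict (x : P) (d : Fin n → ℕ) : BelowIx P n y x →₀ ℤ :=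
  Finsupp.equivFunOnFinite.symm fun i => (d i.1 : ℤ)

lemma AtomEnum.ne_bot (hy : AtomEnum P n y) (i : Fin n) : y i ≠ ⊥ :=
  ((hy.2 (y i)).2 ⟨i, rfl⟩).1

lemma AtomEnum.le_iff (hy : AtomEnum P n y) (i j : Fin n) : y j ≤ y i ↔ j = i := by
  refine ⟨fun hle => hy.1 ?_, fun hij => hij ▸ le_rfl⟩
  exact (((hy.2 (y i)).2 ⟨i, rfl⟩).le_iff.1 hle).resolve_left (hy.ne_bot j)

variable (K) in
/-- The monomial `∏ t_i ^ d_i` in the variables of the atoms. -/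
def atomMonomial (hy : AtomEnum P n y) (d : Fin n → ℕ) : FaceS K P :=
  ∏ i, X ⟨y i, hy.ne_bot i⟩ ^ d i

lemma sum_nsmul_dvec (hy : AtomEnum P n y) (x : P) (d : Fin n → ℕ) :
    ∑ i, d i • dvec P n y x (y i) = atomRestrict x d := by
  ext j
  simp [dvec, atomRestrict, Finsupp.finsetSum_apply, hy.le_iff]

lemma theta_atom (hy : AtomEnum P n y) {x : P} {i : Fin n} (hi : y i ≤ x) :
    theta K P n y x (X ⟨y i, hy.ne_bot i⟩) =
      AddMonoidAlgebra.single (dvec P n y x (y i), 0) 1 := by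
  have hex : ∃ j : Fin n, y j ≤ x ∧ y j = y i := ⟨i, hi, rfl⟩
  simp only [theta, aeval_X, if_pos hi, dif_pos hex, add_zero]

lemma theta_atomMonomial (hy : AtomEnum P n y) {x : P} {d : Fin n → ℕ}
    (hd : ∀ i, d i ≠ 0 → y i ≤ x) :
    theta K P n y x (atomMonomial K hy d) =
      AddMonoidAlgebra.single (atomRestrict x d, 0) 1 := by
  have key : ∀ i, theta K P n y x (X ⟨y i, hy.ne_bot i⟩ ^ d i) =
      AddMonoidAlgebra.of K (EIdx P n y x)
        (Multiplicative.ofAdd (d i • (dvec P n y x (y i), 0))) := by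
    intro i
    by_cases hi : d i = 0
    · simp only [hi, pow_zero, zero_smul, map_one, ofAdd_zero]
    · rw [map_pow, theta_atom hy (hd i hi), ofAdd_nsmul, map_pow]
      rfl
  rw [atomMonomial, map_prod, Finset.prod_congr rfl fun i _ => key i, ← map_prod, ← ofAdd_sum]
  have hsum : ∑ i, d i • ((dvec P n y x (y i), 0) : EIdx P n y x) = (atomRestrict x d, 0) := by
    refine Prod.ext ?_ ?_
    · simp [Prod.fst_sum, sum_nsmul_dvec hy]
    · simp [Prod.snd_sum]
  rw [hsum]
  rfl

lemma atomMonomial_smul_emono (hy : AtomEnum P n y) {x : P} {d : Fin n → ℕ}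
    (hd : ∀ i, d i ≠ 0 → y i ≤ x) (a : BelowIx P n y x →₀ ℤ) (b : Pmx P n y x →₀ ℕ) :
    atomMonomial K hy d • emono K P n y x a b = emono K P n y x (atomRestrict x d + a) b := by
  rw [emono, emono, ← Submodule.Quotient.mk_smul]
  congr 1
  change theta K P n y x (atomMonomial K hy d) * _ = _
  rw [theta_atomMonomial hy hd, AddMonoidAlgebra.single_mul_single, one_mul]
  simp [mIdx]

lemma gdeg_mIdx_add (x : P) (c a : BelowIx P n y x →₀ ℤ) (b : Pmx P n y x →₀ ℕ) (i : Fin n) :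
    gdeg P n y x (mIdx P n y x (c + a) b) i =
      (if hi : y i ≤ x then c ⟨i, hi⟩ else 0) + gdeg P n y x (mIdx P n y x a b) i := by
  simp only [gdeg, mIdx]
  split_ifs <;> simp [add_assoc]

lemma gdeg_mIdx_nonpos {x : P} {i : Fin n} (hi : ¬ y i ≤ x) (a : BelowIx P n y x →₀ ℤ)
    (b : Pmx P n y x →₀ ℕ) : gdeg P n y x (mIdx P n y x a b) i ≤ 0 := by
  simp only [gdeg, dif_neg hi, zero_add, mIdx]
  refine Finset.sum_nonpos fun w _ => ?_
  dsimp only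
  split_ifs <;> simp

lemma atomMonomial_smul_mem_cleanL (hy : AtomEnum P n y) {x : P} {d : Fin n → ℕ}
    (hd : ∀ i, d i ≠ 0 → y i ≤ x) {e : ExMod K P n y x} (he : e ∈ cleanL K P n y x) :
    atomMonomial K hy d • e ∈ cleanL K P n y x := by
  induction he using Submodule.span_induction with
  | mem e he =>
    obtain ⟨a, b, hb, hdeg, rfl⟩ := he
    rw [atomMonomial_smul_emono hy hd]
    refine Submodule.subset_span ⟨_, b, hb, fun i => ?_, rfl⟩
    rw [gdeg_mIdx_add]
    refine add_nonneg ?_ (hdeg i)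
    split_ifs <;> simp [atomRestrict]
  | zero => rw [smul_zero]; exact zero_mem _
  | add e f _ _ he hf => rw [smul_add]; exact add_mem he hf
  | smul k e _ he => rw [smul_comm]; exact Submodule.smul_mem _ k he

/-- A monomial of `*E_x` with a positive exponent in its second factor vanishes; the others are
the monomials `emono`. -/
lemma mk_single_eq_zero_or_eq_mIdx (x : P) (p : EIdx P n y x) :
    (Submodule.Quotient.mk (AddMonoidAlgebra.single p 1) : ExMod K P n y x) = 0 ∨
      ∃ a b, p = mIdx P n y x a b := by
  by_cases hp : ∃ w, 0 < p.2 w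
  · exact .inl ((Submodule.Quotient.mk_eq_zero _).2 (Submodule.subset_span ⟨p, hp, rfl⟩))
  · push Not at hp
    refine .inr ⟨p.1, p.2.mapRange (fun c => (-c).toNat) (by simp), Prod.ext rfl ?_⟩
    ext w
    have := hp w
    simp only [mIdx, Finsupp.neg_apply, Finsupp.mapRange_apply]
    omega

lemma ExGrade_le_cleanL {x : P} {c : Fin n → ℤ} (hc : ∀ i, 0 ≤ c i)
    (hx : ∃ i, c i ≠ 0 ∧ ¬ y i ≤ x) : ExGrade K P n y x c ≤ cleanL K P n y x := by
  refine Submodule.span_le.2 ?_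
  rintro _ ⟨p, hp, rfl⟩
  rcases mk_single_eq_zero_or_eq_mIdx (K := K) x p with h0 | ⟨a, b, rfl⟩
  · rw [h0]; exact zero_mem _
  · obtain ⟨i, hci, hi⟩ := hx
    exact absurd (le_antisymm (hp ▸ gdeg_mIdx_nonpos hi a b) (hc i)) hci

lemma emono_mem_ExGrade (x : P) (a : BelowIx P n y x →₀ ℤ) (b : Pmx P n y x →₀ ℕ) :
    emono K P n y x a b ∈ ExGrade K P n y x (gdeg P n y x (mIdx P n y x a b)) :=
  Submodule.subset_span ⟨_, rfl, rfl⟩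

end ProofLemmas

/-- Lemma 3.5: a degree preserving `ψ : *E_x → *E_z` is clean
provided `ψ(α) ∈ L(*E_z)` for all `α` in the degree `0` part of `L(*E_x)`. -/
theorem statement10
    (hP : IsSimplicialPoset P) (hy : AtomEnum P n y) (x z : P)
    (ψ : ExMod K P n y x →ₗ[FaceS K P] ExMod K P n y z)
    (hdeg : DegZero K P n y x z ψ)
    (h : ∀ α ∈ cleanL K P n y x, α ∈ ExGrade K P n y x 0 → ψ α ∈ cleanL K P n y z) :
    IsClean K P n y x z ψ := by
  refine ⟨hdeg, fun e he => ?_⟩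
  induction he using Submodule.span_induction with
  | mem e he =>
    obtain ⟨a, b, hb, hpos, rfl⟩ := he
    set c := gdeg P n y x (mIdx P n y x a b) with hc
    by_cases hz : ∃ i, c i ≠ 0 ∧ ¬ y i ≤ z
    · exact ExGrade_le_cleanL hpos hz (hdeg _ _ (emono_mem_ExGrade x a b))
    push Not at hz
    have hx : ∀ i, c i ≠ 0 → y i ≤ x := fun i hi => by
      by_contra hix
      exact hi (le_antisymm (gdeg_mIdx_nonpos hix a b) (hpos i))
    set d : Fin n → ℕ := fun i => (c i).toNat with hd
    have hdc : ∀ i, d i ≠ 0 → c i ≠ 0 := fun i hi hci => hi (by simp [hd, hci])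
    have hdeg0 : gdeg P n y x (mIdx P n y x (-atomRestrict x d + a) b) = 0 := by
      funext i
      rw [gdeg_mIdx_add, ← hc]
      by_cases hix : y i ≤ x
      · simp [hix, atomRestrict, hd, hpos i]
      · simpa [hix] using not_imp_comm.1 (hx i) hix
    have hmem : ψ (emono K P n y x (-atomRestrict x d + a) b) ∈ cleanL K P n y z :=
      h _ (Submodule.subset_span ⟨_, b, hb, fun i => by simp [hdeg0], rfl⟩)
        (hdeg0 ▸ emono_mem_ExGrade x _ b)
    have hfactor := atomMonomial_smul_emono (K := K) hy (fun i hi => hx i (hdc i hi))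
      (-atomRestrict x d + a) b
    rw [add_neg_cancel_left] at hfactor
    rw [← hfactor, map_smul]
    exact atomMonomial_smul_mem_cleanL hy (fun i hi => hz i (hdc i hi)) hmem
  | zero => rw [map_zero]; exact zero_mem _
  | add e f _ _ he hf => rw [map_add]; exact add_mem he hf
  | smul k e _ he => rw [LinearMap.map_smul_of_tower]; exact Submodule.smul_mem _ k he

end
end
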